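/- Let B be a CW complex with a subcomplex M such that every cell of B not contained in M has dimension at least 4, let b₀ ∈ M be a 0-cell, assume B is path-connected and πₙ(B, b₀) = 0 for all n ≥ 3, and let ι : M → B denote the inclusion. Let f₁, f₂ : M → M be continuous maps with f₁(b₀) = f₂(b₀) = b₀, and let φ₁, φ₂, φ : B → B be continuous maps fixing b₀ such that φ₁∘ι is pointed homotopic to ι∘f₁, φ₂∘ι is pointed homotopic to ι∘f₂, and φ∘ι is pointed homotopic to ι∘(f₁∘f₂). Then φ is pointed homotopic to φ₁∘φ₂. -/

import Mathlib

open Metric Set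

/-- A CW-complex structure on a topological space `X` (classical definition:
characteristic maps from closed balls whose open cells partition `X`,
closure-finiteness, weak topology). -/
structure CWStructure (X : Type) [TopologicalSpace X] : Type 1 where
  /-- the index set of `n`-cells -/
  cell : ℕ → Type
  /-- characteristic maps -/
  map : (n : ℕ) → cell n → PartialEquiv (Fin n → ℝ) X
  source_eq : ∀ n i, (map n i).source = ball 0 1
  continuousOn : ∀ n i, ContinuousOn (map n i) (closedBall 0 1)
  continuousOn_symm : ∀ n i, ContinuousOn (map n i).symm (map n i).target
  pairwiseDisjoint :
    (univ : Set (Σ n, cell n)).PairwiseDisjoint fun ni => map ni.1 ni.2 '' ball 0 1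
  mapsTo : ∀ n i, ∃ I : (m : ℕ) → Finset (cell m),
    MapsTo (map n i) (sphere 0 1)
      (⋃ (m : ℕ) (_ : m < n) (j ∈ I m), map m j '' closedBall 0 1)
  closed' : ∀ A : Set X, (∀ n i, IsClosed (A ∩ map n i '' closedBall 0 1)) → IsClosed A
  union' : ⋃ (n : ℕ), ⋃ (i : cell n), map n i '' closedBall 0 1 = univ

/-- `M` is a subcomplex of the CW complex `X` with CW structure `S`: a closed
subset which is the union of the closed cells indexed by `cells`. -/
structure CWSubcomplex {X : Type} [TopologicalSpace X] (S : CWStructure X) (M : Set X) where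
  cells : (n : ℕ) → Set (S.cell n)
  isClosed : IsClosed M
  union : ⋃ (n : ℕ), ⋃ (i ∈ cells n), S.map n i '' closedBall 0 1 = M

/-- `x` is (the image of) a `0`-cell of the CW complex. -/
def CWStructure.IsZeroCell {X : Type} [TopologicalSpace X] (S : CWStructure X) (x : X) : Prop :=
  ∃ i : S.cell 0, S.map 0 i 0 = x

/-- Every cell of `B` of dimension `< 4` is contained in `M`; equivalently, every
cell of `B` not contained in `M` has dimension at least `4`. -/
def CWStructure.LowCellsIn {X : Type} [TopologicalSpace X] (S : CWStructure X)
    (M : Set X) : Prop :=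
  ∀ n < 4, ∀ i : S.cell n, S.map n i '' closedBall 0 1 ⊆ M

/-- The inclusion of a subset as a continuous map. -/
def Set.incl {X : Type} [TopologicalSpace X] (M : Set X) : C(M, X) :=
  ⟨Subtype.val, continuous_subtype_val⟩
open scoped unitInterval

section CubeExtension

variable {E Y : Type*} [NormedAddCommGroup E] [NormedSpace ℝ E] [TopologicalSpace Y]

/-- Extendability of a map from the unit sphere to the unit ball is invariant under homotopy. -/
lemma exists_extension_of_homotopy (H : E × ℝ → Y)
    (hH : ContinuousOn H (sphere 0 1 ×ˢ Icc 0 1)) (V : E → Y)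
    (hV : ContinuousOn V (closedBall 0 1)) (hVH : ∀ x ∈ sphere (0 : E) 1, V x = H (x, 1)) :
    ∃ U : E → Y, ContinuousOn U (closedBall 0 1) ∧ ∀ x ∈ sphere (0 : E) 1, U x = H (x, 0) := by
  classical
  refine ⟨fun x ↦ if ‖x‖ ≤ 1 / 2 then V ((2 : ℝ) • x) else H (‖x‖⁻¹ • x, 2 - 2 * ‖x‖), ?_, ?_⟩
  · have hcover : closedBall (0 : E) 1 =
        {x | ‖x‖ ≤ 1 / 2} ∪ ({x | 1 / 2 ≤ ‖x‖} ∩ {x | ‖x‖ ≤ 1}) := by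
      ext x
      simp only [mem_closedBall_zero_iff, mem_union, mem_inter_iff, mem_ofPred_eq]
      grind
    rw [hcover]
    refine ContinuousOn.union_of_isClosed ?_ ?_ (isClosed_le continuous_norm continuous_const)
      ((isClosed_le continuous_const continuous_norm).inter
        (isClosed_le continuous_norm continuous_const))
    · refine ContinuousOn.congr (f := fun x ↦ V ((2 : ℝ) • x)) ?_ fun x hx ↦ if_pos hx
      refine hV.comp (by fun_prop) fun x hx ↦ ?_
      rw [mem_ofPred_eq] at hx
      rw [mem_closedBall_zero_iff, norm_smul, Real.norm_ofNat]
      linarith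
    · have hpos : ∀ x ∈ {x : E | 1 / 2 ≤ ‖x‖} ∩ {x | ‖x‖ ≤ 1}, ‖x‖ ≠ 0 := fun x hx h ↦ by
        have : 1 / 2 ≤ ‖x‖ := hx.1
        norm_num [h] at this
      have hnorm : ∀ x ∈ {x : E | 1 / 2 ≤ ‖x‖} ∩ {x | ‖x‖ ≤ 1}, ‖x‖⁻¹ • x ∈ sphere (0 : E) 1 :=
        fun x hx ↦ by
          rw [mem_sphere_zero_iff_norm, norm_smul, norm_inv, norm_norm, inv_mul_cancel₀ (hpos x hx)]
      refine ContinuousOn.congr (f := fun x ↦ H (‖x‖⁻¹ • x, 2 - 2 * ‖x‖)) ?_ fun x hx ↦ ?_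
      · refine hH.comp ?_ fun x hx ↦ ⟨hnorm x hx, ?_, ?_⟩
        · exact ((continuous_norm.continuousOn.inv₀ hpos).smul continuousOn_id).prodMk (by fun_prop)
        · have : ‖x‖ ≤ 1 := hx.2
          simp only
          linarith
        · have : 1 / 2 ≤ ‖x‖ := hx.1
          simp only
          linarith
      · by_cases h : ‖x‖ ≤ 1 / 2
        · have hx2 : ‖x‖ = 1 / 2 := le_antisymm h hx.1
          have hx3 := hVH _ (hnorm x hx)
          simp only [hx2] at hx3 ⊢
          norm_num at hx3 ⊢
          exact hx3
        · exact if_neg h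
  · intro x hx
    rw [mem_sphere_zero_iff_norm] at hx
    norm_num [hx]

/-- If every map from the unit ball that is constant with value `y₀` on the unit sphere is
nullhomotopic relative to the unit sphere, then in a path-connected space every map from the unit
sphere one dimension higher extends over the unit ball. -/
lemma exists_extension_of_nullhomotopic [PathConnectedSpace Y] (y₀ : Y)
    (hnull : ∀ f : E → Y, ContinuousOn f (closedBall 0 1) → (∀ x ∈ sphere (0 : E) 1, f x = y₀) →
      ∃ G : E × ℝ → Y, ContinuousOn G (closedBall 0 1) ∧
        (∀ x ∈ closedBall (0 : E) 1, G (x, 1) = f x) ∧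
        (∀ x ∈ closedBall (0 : E) 1, G (x, -1) = y₀) ∧
        ∀ x ∈ sphere (0 : E) 1, ∀ s ∈ Icc (-1 : ℝ) 1, G (x, s) = y₀)
    (u : E × ℝ → Y) (hu : ContinuousOn u (sphere 0 1)) :
    ∃ U : E × ℝ → Y, ContinuousOn U (closedBall 0 1) ∧ EqOn U u (sphere 0 1) := by
  classical
  let q : E × ℝ → ℝ := fun v ↦ max v.2 0 * (1 - ‖v.1‖)
  have hq : Continuous q := by fun_prop
  let r : E × ℝ → ℝ := fun v ↦ max 0 (2 * q v - 1)
  have hr : Continuous r := by fun_prop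
  let P : E × ℝ → E × ℝ := fun v ↦ (r v • v.1, 2 * r v - 1)
  have hP : Continuous P := by fun_prop
  have hsphere : ∀ v ∈ sphere (0 : E × ℝ) 1, ‖v.1‖ ≤ 1 ∧ |v.2| ≤ 1 ∧ (‖v.1‖ = 1 ∨ |v.2| = 1) := by
    intro v hv
    rw [mem_sphere_zero_iff_norm, Prod.norm_def, Real.norm_eq_abs] at hv
    grind
  have hq0 : ∀ v ∈ sphere (0 : E × ℝ) 1, 0 ≤ q v := fun v hv ↦
    mul_nonneg (le_max_right _ _) (by linarith [(hsphere v hv).1])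
  have hne : ∀ v ∈ sphere (0 : E × ℝ) 1, ∀ t ∈ Icc (0 : ℝ) 1, (1 - t) • v + t • P v ≠ 0 := by
    intro v hv t ht h0
    obtain ⟨h1, h2⟩ := Prod.ext_iff.1 h0
    simp only [P, Prod.fst_add, Prod.smul_fst, Prod.snd_add, Prod.smul_snd, Prod.fst_zero,
      Prod.snd_zero, smul_smul, ← add_smul, smul_eq_zero, smul_eq_mul] at h1 h2
    have hr0 : 0 ≤ r v := le_max_left _ _
    rcases h1 with h1 | h1
    · have ht1 : 1 - t = 0 := by nlinarith [mul_nonneg ht.1 hr0, ht.2]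
      have hr1 : t * r v = 0 := by nlinarith
      have : t = 1 := by linarith
      subst this
      linarith
    · have hv2 : |v.2| = 1 := by
        rcases (hsphere v hv).2.2 with h | h
        · simp [h1] at h
        · exact h
      rcases eq_or_eq_neg_of_abs_eq hv2 with h | h
      · have hr1 : r v = 1 := by norm_num [r, q, h, h1]
        rw [hr1, h] at h2
        linarith
      · have hr1 : r v = 0 := by norm_num [r, q, h, h1]
        rw [hr1, h] at h2
        linarith
  let N : E × ℝ → E × ℝ := fun v ↦ ‖v‖⁻¹ • v
  have hN : ContinuousOn N {v | v ≠ 0} :=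
    (continuous_norm.continuousOn.inv₀ fun v hv ↦ norm_ne_zero_iff.2 hv).smul continuousOn_id
  have hNs : ∀ v : E × ℝ, v ≠ 0 → N v ∈ sphere (0 : E × ℝ) 1 := fun v hv ↦ by
    rw [mem_sphere_zero_iff_norm, norm_smul, norm_inv, norm_norm,
      inv_mul_cancel₀ (norm_ne_zero_iff.2 hv)]
  have huN : ContinuousOn (fun v ↦ u (N v)) {v | v ≠ 0} := hu.comp hN fun v hv ↦ hNs v hv
  have hPne : ∀ v ∈ sphere (0 : E × ℝ) 1, P v ≠ 0 := fun v hv ↦ by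
    simpa using hne v hv 1 (by simp)
  obtain ⟨γ⟩ := PathConnectedSpace.joined (u (0, -1)) y₀
  have hPq : ∀ v, q v ≤ 1 / 2 → P v = (0, -1) := fun v h ↦ by
    have : r v = 0 := max_eq_left (by linarith)
    simp [P, this]
  have hNp : N (0, -1) = (0, -1) := by simp [N, Prod.norm_def]
  let W : (E × ℝ) × ℝ → Y := fun z ↦
    if q z.1 ≤ 1 / 2 then γ.extend (z.2 * (1 - 2 * q z.1)) else u (N (P z.1))
  have hW : ContinuousOn W (sphere 0 1 ×ˢ Icc 0 1) := by
    have hcover : (sphere 0 1 ×ˢ Icc 0 1 : Set ((E × ℝ) × ℝ)) =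
        ((sphere 0 1 ×ˢ Icc 0 1) ∩ {z | q z.1 ≤ 1 / 2}) ∪
        ((sphere 0 1 ×ˢ Icc 0 1) ∩ {z | 1 / 2 ≤ q z.1}) := by
      rw [← inter_union_distrib_left, eq_comm, inter_eq_left]
      exact fun z _ ↦ le_total (q z.1) (1 / 2)
    have hcl : IsClosed (sphere 0 1 ×ˢ Icc 0 1 : Set ((E × ℝ) × ℝ)) :=
      isClosed_sphere.prod isClosed_Icc
    rw [hcover]
    refine ContinuousOn.union_of_isClosed ?_ ?_
      (hcl.inter (isClosed_le (by fun_prop) (by fun_prop)))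
      (hcl.inter (isClosed_le (by fun_prop) (by fun_prop)))
    · refine ContinuousOn.congr (f := fun z ↦ γ.extend (z.2 * (1 - 2 * q z.1))) ?_
        fun z hz ↦ if_pos (c := q z.1 ≤ 1 / 2) hz.2
      exact (γ.continuous_extend.comp (by fun_prop)).continuousOn
    · refine ContinuousOn.congr (f := fun z ↦ u (N (P z.1))) ?_ fun z hz ↦ ?_
      · exact huN.comp (hP.comp continuous_fst).continuousOn fun z hz ↦ hPne _ hz.1.1
      · by_cases h : q z.1 ≤ 1 / 2
        · have hh : q z.1 = 1 / 2 := le_antisymm h hz.2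
          simp only [W, if_pos h, hPq _ h, hNp, hh]
          norm_num
        · exact if_neg h
  have hW0 : ∀ v ∈ sphere (0 : E × ℝ) 1, W (v, 0) = u (N (P v)) := by
    intro v hv
    by_cases h : q v ≤ 1 / 2
    · simp [W, hPq _ h, hNp]
    · exact if_neg h
  have hW1 : ∀ v : E × ℝ, q v = 0 → W (v, 1) = y₀ := fun v h ↦ by simp [W, h]
  have htop : ∀ x ∈ closedBall (0 : E) 1, (x, (1 : ℝ)) ∈ sphere (0 : E × ℝ) 1 := fun x hx ↦ by
    rw [mem_closedBall_zero_iff] at hx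
    simp [Prod.norm_def, hx]
  obtain ⟨G, hG, hG1, hG2, hG3⟩ := hnull (fun x ↦ W ((x, 1), 1))
    (hW.comp (by fun_prop) fun x hx ↦ ⟨htop x hx, by simp⟩)
    (fun x hx ↦ hW1 _ (by simp [q, mem_sphere_zero_iff_norm.1 hx]))
  obtain ⟨V, hV, hVW⟩ := exists_extension_of_homotopy W hW G hG <| by
    rintro ⟨x, s⟩ hv
    obtain ⟨hx, hs, hxs⟩ := hsphere _ hv
    rcases hxs with h | h
    · rw [hG3 x (by simpa using h) s (abs_le.1 hs), hW1 _ (by simp [q, h])]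
    · have hx' : x ∈ closedBall (0 : E) 1 := by simpa using hx
      rcases eq_or_eq_neg_of_abs_eq h with h | h
      · simp only at h
        rw [h, hG1 x hx']
      · simp only at h
        rw [h, hG2 x hx', hW1 _ (by simp [q])]
  obtain ⟨U, hU, hUu⟩ := exists_extension_of_homotopy
    (fun z ↦ u (N ((1 - z.2) • z.1 + z.2 • P z.1)))
    (huN.comp (by fun_prop) fun z hz ↦ hne _ hz.1 _ hz.2) V hV fun v hv ↦ by
      simp [hVW v hv, hW0 v hv]
  refine ⟨U, hU, fun v hv ↦ ?_⟩
  simp [hUu v hv, N, mem_sphere_zero_iff_norm.1 hv]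

/-- The vanishing of the `n`-th homotopy group, on the cube `[-1, 1]ⁿ`. -/
lemma exists_nullhomotopy_of_subsingleton_homotopyGroup {n : ℕ} (y₀ : Y)
    (hπ : Subsingleton (HomotopyGroup (Fin n) Y y₀)) (f : (Fin n → ℝ) → Y)
    (hf : ContinuousOn f (closedBall 0 1)) (hf₀ : ∀ x ∈ sphere (0 : Fin n → ℝ) 1, f x = y₀) :
    ∃ G : (Fin n → ℝ) × ℝ → Y, ContinuousOn G (closedBall 0 1) ∧
      (∀ x ∈ closedBall (0 : Fin n → ℝ) 1, G (x, 1) = f x) ∧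
      (∀ x ∈ closedBall (0 : Fin n → ℝ) 1, G (x, -1) = y₀) ∧
      ∀ x ∈ sphere (0 : Fin n → ℝ) 1, ∀ s ∈ Icc (-1 : ℝ) 1, G (x, s) = y₀ := by
  let a : (Fin n → I) → Fin n → ℝ := fun y i ↦ 2 * (y i : ℝ) - 1
  have ha : Continuous a := by fun_prop
  have hab : ∀ y, a y ∈ closedBall (0 : Fin n → ℝ) 1 := fun y ↦ by
    rw [mem_closedBall_zero_iff, pi_norm_le_iff_of_nonneg zero_le_one]
    intro i
    rw [Real.norm_eq_abs, abs_le]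
    constructor <;> linarith [(y i).2.1, (y i).2.2]
  have has : ∀ y ∈ Cube.boundary (Fin n), a y ∈ sphere (0 : Fin n → ℝ) 1 := by
    rintro y ⟨i, hi⟩
    rw [mem_sphere_zero_iff_norm]
    refine le_antisymm (mem_closedBall_zero_iff.1 (hab y)) ?_
    refine le_trans ?_ (norm_le_pi_norm _ i)
    rcases hi with h | h <;> norm_num [a, h]
  let c : ℝ → I := fun s ↦ projIcc 0 1 zero_le_one ((s + 1) / 2)
  have hc : Continuous c := continuous_projIcc.comp (by fun_prop)
  have hac : ∀ x ∈ closedBall (0 : Fin n → ℝ) 1, a (fun i ↦ c (x i)) = x := by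
    intro x hx
    ext i
    have hi := (norm_le_pi_norm x i).trans (mem_closedBall_zero_iff.1 hx)
    rw [Real.norm_eq_abs, abs_le] at hi
    simp only [a, c]
    rw [projIcc_of_mem zero_le_one (x := (x i + 1) / 2) ⟨by linarith, by linarith⟩]
    ring
  have hcs : ∀ x ∈ sphere (0 : Fin n → ℝ) 1, (fun i ↦ c (x i)) ∈ Cube.boundary (Fin n) := by
    intro x hx
    rw [mem_sphere_zero_iff_norm] at hx
    obtain ⟨i, hi⟩ : ∃ i, 1 ≤ ‖x i‖ := by
      by_contra! h
      exact ((pi_norm_lt_iff zero_lt_one).2 h).ne hx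
    refine ⟨i, ?_⟩
    rw [Real.norm_eq_abs, le_abs] at hi
    rcases hi with h | h
    · exact Or.inr (projIcc_of_right_le _ (by linarith))
    · exact Or.inl (projIcc_of_le_left _ (by linarith))
  let p : GenLoop (Fin n) Y y₀ :=
    ⟨⟨fun y ↦ f (a y), hf.comp_continuous ha hab⟩, fun y hy ↦ hf₀ _ (has y hy)⟩
  have hp : GenLoop.Homotopic (GenLoop.const : GenLoop (Fin n) Y y₀) p :=
    Quotient.exact (Subsingleton.elim (α := HomotopyGroup (Fin n) Y y₀) _ _)
  obtain ⟨F⟩ := hp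
  refine ⟨fun v ↦ F (c v.2, fun i ↦ c (v.1 i)), ?_, ?_, ?_, ?_⟩
  · exact Continuous.continuousOn (by fun_prop)
  · intro x hx
    have : c 1 = 1 := projIcc_of_right_le _ (by norm_num)
    simp only [this, F.apply_one]
    change f (a _) = f x
    rw [hac x hx]
  · intro x hx
    have : c (-1) = 0 := projIcc_of_le_left _ (by norm_num)
    simp only [this, F.apply_zero]
    rfl
  · intro x hx s _
    exact F.eq_fst _ (hcs x hx)

/-- Over an `n`-cube, a homotopy between `g₀` and `g₁` given on the boundary extends to the whole
cube when the target is path connected with trivial `n`-th homotopy group. -/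
lemma exists_homotopy_extension_of_subsingleton_homotopyGroup [PathConnectedSpace Y] {n : ℕ}
    (y₀ : Y) (hπ : Subsingleton (HomotopyGroup (Fin n) Y y₀)) (g₀ g₁ : (Fin n → ℝ) → Y)
    (hg₀ : ContinuousOn g₀ (closedBall 0 1)) (hg₁ : ContinuousOn g₁ (closedBall 0 1))
    (h : (Fin n → ℝ) → C(I, Y)) (hh : ContinuousOn h (sphere 0 1))
    (hg : ∀ x ∈ sphere (0 : Fin n → ℝ) 1, h x 0 = g₀ x ∧ h x 1 = g₁ x) :
    ∃ H : (Fin n → ℝ) → C(I, Y), ContinuousOn H (closedBall 0 1) ∧ EqOn H h (sphere 0 1) ∧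
      ∀ x ∈ closedBall (0 : Fin n → ℝ) 1, H x 0 = g₀ x ∧ H x 1 = g₁ x := by
  classical
  let c : ℝ → I := fun s ↦ projIcc 0 1 zero_le_one ((s + 1) / 2)
  have hc : Continuous c := continuous_projIcc.comp (by fun_prop)
  have hcbot : c (-1) = 0 := projIcc_of_le_left _ (by norm_num)
  have hctop : c 1 = 1 := projIcc_of_right_le _ (by norm_num)
  let u : (Fin n → ℝ) × ℝ → Y := fun v ↦
    if v.2 = -1 then g₀ v.1 else if v.2 = 1 then g₁ v.1 else h v.1 (c v.2)
  have hbot : ∀ x, u (x, -1) = g₀ x := fun x ↦ by simp [u]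
  have htop : ∀ x, u (x, 1) = g₁ x := fun x ↦ by norm_num [u]
  have hside : ∀ x ∈ sphere (0 : Fin n → ℝ) 1, ∀ s, u (x, s) = h x (c s) := by
    intro x hx s
    simp only [u]
    split_ifs with h₁ h₂
    · rw [h₁, hcbot, (hg x hx).1]
    · rw [h₂, hctop, (hg x hx).2]
    · rfl
  have hu : ContinuousOn u (sphere 0 1) := by
    have hcover : sphere (0 : (Fin n → ℝ) × ℝ) 1 ⊆
        (closedBall 0 1 ×ˢ {-1} ∪ closedBall 0 1 ×ˢ {1}) ∪ sphere 0 1 ×ˢ univ := by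
      rintro ⟨x, s⟩ hv
      rw [mem_sphere_zero_iff_norm, Prod.norm_def, Real.norm_eq_abs] at hv
      simp only [mem_union, mem_prod, mem_closedBall_zero_iff, mem_singleton_iff,
        mem_sphere_zero_iff_norm, mem_univ, and_true]
      grind
    refine ContinuousOn.mono ?_ hcover
    refine ContinuousOn.union_of_isClosed (ContinuousOn.union_of_isClosed ?_ ?_
      (isClosed_closedBall.prod isClosed_singleton) (isClosed_closedBall.prod isClosed_singleton))
      ?_ ((isClosed_closedBall.prod isClosed_singleton).union
        (isClosed_closedBall.prod isClosed_singleton)) (isClosed_sphere.prod isClosed_univ)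
    · refine (hg₀.comp continuousOn_fst fun v hv ↦ hv.1).congr ?_
      rintro ⟨x, s⟩ ⟨-, rfl⟩
      exact hbot x
    · refine (hg₁.comp continuousOn_fst fun v hv ↦ hv.1).congr ?_
      rintro ⟨x, s⟩ ⟨-, rfl⟩
      exact htop x
    · refine ContinuousOn.congr (f := fun v ↦ h v.1 (c v.2)) ?_ fun v hv ↦ hside v.1 hv.1 v.2
      exact (hh.comp continuousOn_fst fun v hv ↦ hv.1).eval
        (hc.comp continuous_snd).continuousOn
  obtain ⟨U, hU, hUu⟩ := exists_extension_of_nullhomotopic y₀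
    (exists_nullhomotopy_of_subsingleton_homotopyGroup y₀ hπ) u hu
  have hmem : ∀ x ∈ closedBall (0 : Fin n → ℝ) 1, ∀ t : I,
      (x, 2 * (t : ℝ) - 1) ∈ closedBall (0 : (Fin n → ℝ) × ℝ) 1 := by
    intro x hx t
    rw [mem_closedBall_zero_iff] at hx ⊢
    rw [Prod.norm_def, max_le_iff, Real.norm_eq_abs, abs_le]
    exact ⟨hx, by linarith [t.2.1], by linarith [t.2.2]⟩
  let K : C(closedBall (0 : Fin n → ℝ) 1, C(I, Y)) := ContinuousMap.curry
    ⟨fun z ↦ U (z.1, 2 * (z.2 : ℝ) - 1),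
      hU.comp_continuous (by fun_prop) fun z ↦ hmem z.1 z.1.2 z.2⟩
  refine ⟨fun x ↦ if hx : x ∈ closedBall 0 1 then K ⟨x, hx⟩ else h x, ?_, ?_, ?_⟩
  · rw [continuousOn_iff_continuous_domRestrict]
    convert K.continuous using 1
    ext1 x
    exact dif_pos x.2
  · intro x hx
    simp only [dif_pos (sphere_subset_closedBall hx)]
    ext t
    change U (x, 2 * (t : ℝ) - 1) = _
    rw [hUu, hside x hx]
    · congr 1
      simp [c]
    · have := hmem x (sphere_subset_closedBall hx) t
      rw [mem_closedBall_zero_iff] at this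
      rw [mem_sphere_zero_iff_norm] at hx ⊢
      refine le_antisymm this ?_
      rw [← hx]
      exact le_max_left _ _
  · intro x hx
    simp only [dif_pos hx]
    have hx1 := mem_closedBall_zero_iff.1 hx
    constructor
    · change U (x, 2 * ((0 : I) : ℝ) - 1) = _
      rw [← hbot, ← hUu (by simp [Prod.norm_def, hx1])]
      norm_num
    · change U (x, 2 * ((1 : I) : ℝ) - 1) = _
      rw [← htop, ← hUu (by simp [Prod.norm_def, hx1])]
      norm_num

end CubeExtension

namespace CWStructure

variable {X : Type} [TopologicalSpace X] (S : CWStructure X)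

/-- The union of the closed cells of dimension less than `n`. -/
def skeletonLT (n : ℕ) : Set X :=
  {x | ∃ m < n, ∃ j : S.cell m, x ∈ S.map m j '' closedBall 0 1}

lemma image_closedBall_subset_skeletonLT {m n : ℕ} (h : m < n) (j : S.cell m) :
    S.map m j '' closedBall 0 1 ⊆ S.skeletonLT n :=
  fun _ hx ↦ ⟨m, h, j, hx⟩

lemma exists_mem_image_closedBall (x : X) :
    ∃ n, ∃ i : S.cell n, x ∈ S.map n i '' closedBall 0 1 := by
  have hx := mem_univ x
  rw [← S.union'] at hx
  simpa only [mem_iUnion] using hx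

lemma map_mem_skeletonLT {n : ℕ} (i : S.cell n) {y : Fin n → ℝ} (hy : y ∈ sphere 0 1) :
    S.map n i y ∈ S.skeletonLT n := by
  obtain ⟨J, hJ⟩ := S.mapsTo n i
  have := hJ hy
  simp only [mem_iUnion] at this
  obtain ⟨m, hm, j, -, hj⟩ := this
  exact ⟨m, hm, j, hj⟩

lemma exists_mem_image_ball {n : ℕ} {x : X} (hx : x ∈ S.skeletonLT n) :
    ∃ m < n, ∃ j : S.cell m, x ∈ S.map m j '' ball 0 1 := by
  induction n using Nat.strong_induction_on with
  | _ n ih =>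
    obtain ⟨m, hm, j, y, hy, rfl⟩ := hx
    rw [← ball_union_sphere] at hy
    rcases hy with hy | hy
    · exact ⟨m, hm, j, y, hy, rfl⟩
    · obtain ⟨k, hk, i, hi⟩ := ih m hm (S.map_mem_skeletonLT j hy)
      exact ⟨k, hk.trans hm, i, hi⟩

lemma sigma_eq_of_mem_image_ball {m n : ℕ} {i : S.cell m} {j : S.cell n} {x : X}
    (hi : x ∈ S.map m i '' ball 0 1) (hj : x ∈ S.map n j '' ball 0 1) :
    (⟨m, i⟩ : Σ n, S.cell n) = ⟨n, j⟩ :=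
  S.pairwiseDisjoint.elim (mem_univ _) (mem_univ _) (not_disjoint_iff.2 ⟨x, hi, hj⟩)

lemma notMem_skeletonLT {n : ℕ} {i : S.cell n} {x : X} (hx : x ∈ S.map n i '' ball 0 1) :
    x ∉ S.skeletonLT n := by
  intro h
  obtain ⟨m, hm, j, hj⟩ := S.exists_mem_image_ball h
  exact hm.ne (Sigma.mk.inj_iff.1 (S.sigma_eq_of_mem_image_ball hj hx)).1

variable [T2Space X] {P : Type*} [TopologicalSpace P] {f : X → P}

lemma isClosed_image_closedBall {n : ℕ} (i : S.cell n) :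
    IsClosed (S.map n i '' closedBall 0 1) :=
  ((isCompact_closedBall _ _).image_of_continuousOn (S.continuousOn n i)).isClosed

lemma isClosed_preimage_inter_cell {n : ℕ} {i : S.cell n}
    (hf : ContinuousOn (f ∘ S.map n i) (closedBall 0 1)) {A : Set P} (hA : IsClosed A) :
    IsClosed (f ⁻¹' A ∩ S.map n i '' closedBall 0 1) := by
  have h : f ⁻¹' A ∩ S.map n i '' closedBall 0 1 =
      S.map n i '' (closedBall 0 1 ∩ (f ∘ S.map n i) ⁻¹' A) := by
    ext x
    constructor
    · rintro ⟨hx, y, hy, rfl⟩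
      exact ⟨y, ⟨hy, hx⟩, rfl⟩
    · rintro ⟨y, ⟨hy, hx⟩, rfl⟩
      exact ⟨hx, y, hy, rfl⟩
  rw [h]
  refine IsCompact.isClosed (IsCompact.image_of_continuousOn ?_
    ((S.continuousOn n i).mono inter_subset_left))
  exact (isCompact_closedBall _ _).of_isClosed_subset
    (hf.preimage_isClosed_of_isClosed isClosed_closedBall hA) inter_subset_left

lemma continuousOn_image_closedBall {n : ℕ} {i : S.cell n}
    (hf : ContinuousOn (f ∘ S.map n i) (closedBall 0 1)) :
    ContinuousOn f (S.map n i '' closedBall 0 1) :=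
  continuousOn_iff_isClosed.2 fun A hA ↦
    ⟨_, S.isClosed_preimage_inter_cell hf hA, by rw [inter_assoc, inter_self]⟩

/-- A map on a CW complex is continuous if its composites with all characteristic maps are. -/
lemma continuous_of_continuousOn_comp_map
    (hf : ∀ n (i : S.cell n), ContinuousOn (f ∘ S.map n i) (closedBall 0 1)) : Continuous f :=
  continuous_iff_isClosed.2 fun _ hA ↦
    S.closed' _ fun n i ↦ S.isClosed_preimage_inter_cell (hf n i) hA

lemma continuousOn_comp_map_sphere {n : ℕ} (i : S.cell n)
    (hf : ∀ m < n, ∀ j : S.cell m, ContinuousOn (f ∘ S.map m j) (closedBall 0 1)) :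
    ContinuousOn (f ∘ S.map n i) (sphere 0 1) := by
  obtain ⟨J, hJ⟩ := S.mapsTo n i
  refine ContinuousOn.comp (t := ⋃ p : Σ m : Fin n, J m,
    S.map p.1 p.2 '' closedBall 0 1) ?_ ((S.continuousOn n i).mono sphere_subset_closedBall) ?_
  · exact (locallyFinite_of_finite _).continuousOn_iUnion
      (fun p ↦ S.isClosed_image_closedBall _)
      fun p ↦ S.continuousOn_image_closedBall (hf _ p.1.2 _)
  · intro y hy
    have := hJ hy
    simp only [mem_iUnion] at this ⊢
    obtain ⟨m, hm, j, hj, h⟩ := this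
    exact ⟨⟨⟨m, hm⟩, j, hj⟩, h⟩

/-- A continuous section of a relation `R` over the cells of dimension `< n` of a CW complex
extends over the `n`-cells, provided that it extends over each of them separately. -/
lemma exists_extension_succ (R : X → P → Prop) {n : ℕ}
    (hext : ∀ (i : S.cell n) (h : (Fin n → ℝ) → P), ContinuousOn h (sphere 0 1) →
      (∀ y ∈ sphere 0 1, R (S.map n i y) (h y)) →
      ∃ H : (Fin n → ℝ) → P, ContinuousOn H (closedBall 0 1) ∧ EqOn H h (sphere 0 1) ∧
        ∀ y ∈ closedBall 0 1, R (S.map n i y) (H y))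
    (hf : ∀ m < n, ∀ j : S.cell m, ContinuousOn (f ∘ S.map m j) (closedBall 0 1))
    (hR : ∀ x ∈ S.skeletonLT n, R x (f x)) :
    ∃ g : X → P, EqOn g f (S.skeletonLT n) ∧
      (∀ m < n + 1, ∀ j : S.cell m, ContinuousOn (g ∘ S.map m j) (closedBall 0 1)) ∧
      ∀ x ∈ S.skeletonLT (n + 1), R x (g x) := by
  classical
  choose H hHc hHf hHR using fun i ↦ hext i (f ∘ S.map n i) (S.continuousOn_comp_map_sphere i hf)
    fun y hy ↦ hR _ (S.map_mem_skeletonLT i hy)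
  let g : X → P := fun x ↦
    if h : ∃ i : S.cell n, x ∈ S.map n i '' ball 0 1 then H h.choose ((S.map n h.choose).symm x)
    else f x
  have hgf : EqOn g f (S.skeletonLT n) := fun x hx ↦
    dif_neg fun ⟨i, hi⟩ ↦ S.notMem_skeletonLT hi hx
  have hgH : ∀ i, EqOn (g ∘ S.map n i) (H i) (closedBall 0 1) := by
    intro i y hy
    rw [← ball_union_sphere] at hy
    rcases hy with hy | hy
    · have h : ∃ j : S.cell n, S.map n i y ∈ S.map n j '' ball 0 1 := ⟨i, y, hy, rfl⟩
      have hi : h.choose = i := by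
        have := S.sigma_eq_of_mem_image_ball h.choose_spec ⟨y, hy, rfl⟩
        exact eq_of_heq (Sigma.mk.inj_iff.1 this).2
      change g (S.map n i y) = _
      simp only [g, dif_pos h]
      rw [hi, (S.map n i).left_inv (by rwa [S.source_eq])]
    · exact (hgf (S.map_mem_skeletonLT i hy)).trans (hHf i hy).symm
  refine ⟨g, hgf, fun m hm j ↦ ?_, ?_⟩
  · rcases Nat.lt_succ_iff_lt_or_eq.1 hm with hm | rfl
    · exact (hf m hm j).congr fun y hy ↦
        hgf (S.image_closedBall_subset_skeletonLT hm j ⟨y, hy, rfl⟩)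
    · exact (hHc j).congr (hgH j)
  · rintro x ⟨m, hm, j, hx⟩
    rcases Nat.lt_succ_iff_lt_or_eq.1 hm with hm | rfl
    · have hx := S.image_closedBall_subset_skeletonLT hm j hx
      rw [hgf hx]
      exact hR x hx
    · obtain ⟨y, hy, rfl⟩ := hx
      have := hHR j y hy
      rwa [← hgH j hy] at this

/-- A continuous section of a relation `R` over the cells of dimension `< k` of a CW complex
extends to the whole complex, provided that sections extend over each cell of dimension `≥ k`. -/
lemma exists_continuous_extension (R : X → P → Prop) {k : ℕ}
    (hext : ∀ n, k ≤ n → ∀ (i : S.cell n) (h : (Fin n → ℝ) → P), ContinuousOn h (sphere 0 1) →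
      (∀ y ∈ sphere 0 1, R (S.map n i y) (h y)) →
      ∃ H : (Fin n → ℝ) → P, ContinuousOn H (closedBall 0 1) ∧ EqOn H h (sphere 0 1) ∧
        ∀ y ∈ closedBall 0 1, R (S.map n i y) (H y))
    (hf : ∀ m < k, ∀ j : S.cell m, ContinuousOn (f ∘ S.map m j) (closedBall 0 1))
    (hR : ∀ x ∈ S.skeletonLT k, R x (f x)) :
    ∃ g : X → P, Continuous g ∧ EqOn g f (S.skeletonLT k) ∧ ∀ x, R x (g x) := by
  let T : ℕ → (X → P) → Prop := fun n g ↦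
    (∀ m < k + n, ∀ j : S.cell m, ContinuousOn (g ∘ S.map m j) (closedBall 0 1)) ∧
      ∀ x ∈ S.skeletonLT (k + n), R x (g x)
  have hstep : ∀ n (g : {g // T n g}), ∃ g' : {g // T (n + 1) g},
      EqOn g'.1 g.1 (S.skeletonLT (k + n)) := fun n ⟨g, hg⟩ ↦ by
    obtain ⟨g', h₁, h₂⟩ := S.exists_extension_succ R (hext (k + n) (by omega)) hg.1 hg.2
    exact ⟨⟨g', h₂⟩, h₁⟩
  choose next hnext using hstep
  let F : ∀ n, {g // T n g} := fun n ↦ Nat.rec ⟨f, hf, hR⟩ next n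
  have hF : ∀ m n, m ≤ n → EqOn (F n).1 (F m).1 (S.skeletonLT (k + m)) := by
    intro m n hmn
    induction n, hmn using Nat.le_induction with
    | base => exact fun _ _ ↦ rfl
    | succ n hn ih =>
      intro x hx
      refine (hnext n (F n) ?_).trans (ih hx)
      obtain ⟨l, hl, j, hj⟩ := hx
      exact ⟨l, by omega, j, hj⟩
  have hmem : ∀ x, ∃ n, x ∈ S.skeletonLT (k + n) := fun x ↦ by
    obtain ⟨n, i, hi⟩ := S.exists_mem_image_closedBall x
    exact ⟨n + 1, n, by omega, i, hi⟩
  choose d hd using hmem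
  have hdF : ∀ x n, x ∈ S.skeletonLT (k + n) → (F (d x)).1 x = (F n).1 x := fun x n hx ↦ by
    rcases le_total (d x) n with h | h
    · exact (hF _ _ h (hd x)).symm
    · exact hF _ _ h hx
  refine ⟨fun x ↦ (F (d x)).1 x, S.continuous_of_continuousOn_comp_map fun n i ↦ ?_,
    fun x hx ↦ hdF x 0 hx, fun x ↦ (F (d x)).2.2 x (hd x)⟩
  exact ((F (n + 1)).2.1 n (by omega) i).congr fun y hy ↦
    hdF (S.map n i y) (n + 1)
      (S.image_closedBall_subset_skeletonLT (by omega) i ⟨y, hy, rfl⟩)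

/-- Let `M` contain all cells of dimension less than `k` of a CW complex `X`, where `k > 0`, and let
`Y` be a path-connected space with trivial homotopy groups in dimensions at least `k`. Then two maps
`X → Y` are homotopic relative to a `0`-cell as soon as their restrictions to `M` are. -/
lemma homotopicRel_of_homotopicRel_comp_incl {k : ℕ} (hk : 0 < k) {M : Set X}
    (hM : ∀ n < k, ∀ i : S.cell n, S.map n i '' closedBall 0 1 ⊆ M)
    {b₀ : X} (hb₀ : b₀ ∈ M) (hb₀cell : S.IsZeroCell b₀) {Y : Type*} [TopologicalSpace Y]
    [PathConnectedSpace Y] {y₀ : Y}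
    (hπ : ∀ n : ℕ, k ≤ n → Subsingleton (HomotopyGroup (Fin n) Y y₀)) {g₀ g₁ : C(X, Y)}
    (h : (g₀.comp (Set.incl M)).HomotopicRel (g₁.comp (Set.incl M)) {(⟨b₀, hb₀⟩ : M)}) :
    g₀.HomotopicRel g₁ {b₀} := by
  classical
  obtain ⟨F⟩ := h
  let K : C(M, C(I, Y)) := ContinuousMap.curry ⟨fun z ↦ F (z.2, z.1), by fun_prop⟩
  let f : X → C(I, Y) := fun x ↦ if hx : x ∈ M then K ⟨x, hx⟩ else .const _ (g₀ x)
  have hfM : ∀ x (hx : x ∈ M) t, f x t = F (t, ⟨x, hx⟩) := fun x hx t ↦ by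
    simp only [f, dif_pos hx]
    rfl
  have hfc : ContinuousOn f M := by
    rw [continuousOn_iff_continuous_domRestrict]
    convert K.continuous using 1
    ext1 x
    exact dif_pos x.2
  obtain ⟨g, hg, hgf, hgR⟩ := S.exists_continuous_extension (f := f) (k := k)
    (fun x p ↦ p 0 = g₀ x ∧ p 1 = g₁ x)
    (fun n hn i h hh hhR ↦ exists_homotopy_extension_of_subsingleton_homotopyGroup y₀ (hπ n hn)
      (g₀ ∘ S.map n i) (g₁ ∘ S.map n i) (g₀.continuous.comp_continuousOn (S.continuousOn n i))
      (g₁.continuous.comp_continuousOn (S.continuousOn n i)) h hh hhR)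
    (fun m hm j ↦ hfc.comp (S.continuousOn m j) fun y hy ↦ hM m hm j ⟨y, hy, rfl⟩)
    (by
      rintro x ⟨m, hm, j, hx⟩
      rw [hfM x (hM m hm j hx), hfM x (hM m hm j hx), F.apply_zero, F.apply_one]
      exact ⟨rfl, rfl⟩)
  refine ⟨⟨⟨⟨fun z ↦ g z.2 z.1, by fun_prop⟩, fun x ↦ (hgR x).1, fun x ↦ (hgR x).2⟩, ?_⟩⟩
  rintro t x rfl
  have hb : x ∈ S.skeletonLT k := by
    obtain ⟨i, rfl⟩ := hb₀cell
    exact ⟨0, hk, i, 0, by simp, rfl⟩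
  change g x t = g₀ x
  rw [hgf hb, hfM x hb₀, F.eq_fst t rfl]
  rfl

end CWStructure

/-- Precomposition of a relative homotopy with a map of pairs. -/
lemma ContinuousMap.HomotopicRel.comp_of_mapsTo {X Y Z : Type*} [TopologicalSpace X]
    [TopologicalSpace Y] [TopologicalSpace Z] {f₀ f₁ : C(Y, Z)} {T : Set Y}
    (h : f₀.HomotopicRel f₁ T) {S : Set X} (g : C(X, Y)) (hg : MapsTo g S T) :
    (f₀.comp g).HomotopicRel (f₁.comp g) S := by
  obtain ⟨F⟩ := h
  refine ⟨⟨⟨⟨fun z ↦ F (z.1, g z.2), by fun_prop⟩, fun x ↦ ?_, fun x ↦ ?_⟩, fun t x hx ↦ ?_⟩⟩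
  · exact F.apply_zero _
  · exact F.apply_one _
  · exact F.eq_fst t (hg hx)


/-- Multiplicativity of the extension over the 2-type: if `φ₁, φ₂, φ` are pointed
self-maps of `B` whose restrictions to the subcomplex `M` are pointed homotopic
to `ι∘f₁`, `ι∘f₂` and `ι∘(f₁∘f₂)` respectively, where all cells of `B` not in `M`
have dimension at least `4`, `B` is path-connected, and `πₙ(B) = 0` for `n ≥ 3`,
then `φ` is pointed homotopic to `φ₁ ∘ φ₂`. -/
theorem extension_multiplicative {B : Type} [TopologicalSpace B] [T2Space B]
    [PathConnectedSpace B]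
    (S : CWStructure B) (M : Set B) (hM : CWSubcomplex S M)
    (hcells : S.LowCellsIn M)
    (b₀ : B) (hb₀ : b₀ ∈ M) (hb₀cell : S.IsZeroCell b₀)
    (hπ : ∀ n : ℕ, 3 ≤ n → Subsingleton (HomotopyGroup (Fin n) B b₀))
    (f₁ f₂ : C(M, M)) (hf₁ : f₁ ⟨b₀, hb₀⟩ = ⟨b₀, hb₀⟩) (hf₂ : f₂ ⟨b₀, hb₀⟩ = ⟨b₀, hb₀⟩)
    (φ₁ φ₂ φ : C(B, B)) (hφ₁x : φ₁ b₀ = b₀) (hφ₂x : φ₂ b₀ = b₀) (hφx : φ b₀ = b₀)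
    (hφ₁ : (φ₁.comp (Set.incl M)).HomotopicRel ((Set.incl M).comp f₁) {(⟨b₀, hb₀⟩ : M)})
    (hφ₂ : (φ₂.comp (Set.incl M)).HomotopicRel ((Set.incl M).comp f₂) {(⟨b₀, hb₀⟩ : M)})
    (hφ : (φ.comp (Set.incl M)).HomotopicRel ((Set.incl M).comp (f₁.comp f₂))
      {(⟨b₀, hb₀⟩ : M)}) :
    φ.HomotopicRel (φ₁.comp φ₂) {b₀} := by
  refine S.homotopicRel_of_homotopicRel_comp_incl (k := 4) (by norm_num) hcells hb₀ hb₀cell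
    (fun n hn ↦ hπ n (by omega)) (hφ.trans ?_)
  refine ContinuousMap.HomotopicRel.symm ((hφ₂.comp_continuousMap φ₁).trans ?_)
  refine hφ₁.comp_of_mapsTo f₂ ?_
  rintro x rfl
  exact hf₂
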